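/- (Correctness of the subset-sum reduction) Let z_1, …, z_n and Z be positive integers with Z > z_i for all i. Set v̄ = 1 + Σ_{i∈[n]} z_i, c̄ = 1 + max_{i∈[n]} z_i, let k be a positive integer with 2^{kn} > Z + 2kn·c̄ + 1, and let B = Z + 2kn·c̄ + 1. Consider the knapsack scoring instance with (2k+1)n tasks, state-revelation probability p_i = 1 for every task, costs and values c_i = v_i = z_i for i ≤ n and c_i = c̄, v_i = v̄ for n < i ≤ (2k+1)n, additive value v(Ψ) = Σ_{i∈Ψ} v_i, and scores required to lie in [0, B]. Then the optimal value of the knapsack scoring problem (the maximum of v(Ψ) over incentive compatible mechanisms (S, Ψ) with S taking values in [0, B]) equals Z + 2kn·v̄ if and only if there exists Ψ ⊆ [n] with Σ_{i∈Ψ} z_i = Z. -/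

import Mathlib

open Finset

namespace KS

abbrev Sig (n : ℕ) := Fin n → Option Bool
abbrev St (n : ℕ) := Fin n → Bool

/-- Posterior probability of state profile `ω` induced by signal profile `σ`:
`ω i = b` with probability 1 when `σ i = some b`, uniform when `σ i = none`. -/
noncomputable def postProb {n : ℕ} (σ : Sig n) (ω : St n) : ℝ :=
  ∏ i, (σ i).elim ((1:ℝ)/2) (fun b => if ω i = b then 1 else 0)

/-- Expectation of `f` over states, under the posterior induced by `σ`. -/
noncomputable def postExp {n : ℕ} (σ : Sig n) (f : St n → ℝ) : ℝ :=
  ∑ ω : St n, postProb σ ω * f ω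

/-- A scoring rule is proper if truthful reporting of the signal maximizes the
expected score under the induced posterior. -/
def Proper {n : ℕ} (S : Sig n → St n → ℝ) : Prop :=
  ∀ σ σ' : Sig n, postExp σ (S σ) ≥ postExp σ (S σ')

/-- Probability of receiving signal profile `σ` when exerting effort exactly on `Ψ`
(with state-revelation probabilities `p`, states uniform and independent). -/
noncomputable def sigProb {n : ℕ} (p : Fin n → ℝ) (Ψ : Finset (Fin n)) (σ : Sig n) : ℝ :=
  ∏ i, if i ∈ Ψ then (σ i).elim (1 - p i) (fun _ => p i / 2)
       else (σ i).elim 1 (fun _ => 0)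

/-- Expected score `E_{σ∼Ψ}[E_{ω∼σ}[S(σ,ω)]]` for exerting effort on `Ψ` and
truthfully reporting. -/
noncomputable def expScore {n : ℕ} (p : Fin n → ℝ) (Ψ : Finset (Fin n))
    (S : Sig n → St n → ℝ) : ℝ :=
  ∑ σ : Sig n, sigProb p Ψ σ * postExp σ (S σ)

/-- Incentive compatibility of the mechanism `(S, Ψ)`. -/
def IC {n : ℕ} (p c : Fin n → ℝ) (S : Sig n → St n → ℝ) (Ψ : Finset (Fin n)) : Prop :=
  Proper S ∧ ∀ Ψ' : Finset (Fin n),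
    expScore p Ψ S - ∑ i ∈ Ψ, c i ≥ expScore p Ψ' S - ∑ i ∈ Ψ', c i

/-- Truncated separate scoring rule with budget `B`. -/
def IsTruncSep {n : ℕ} (B : ℝ) (S : Sig n → St n → ℝ) : Prop :=
  ∃ (T : Fin n → Option Bool → Bool → ℝ) (d : ℝ),
    ∀ σ ω, S σ ω = min B (max 0 (-d + ∑ i, T i (σ i) (ω i)))

open Classical in
/-- Threshold scoring rule with recommendation set `Ψ` and threshold `η`. -/
noncomputable def thresholdScore {n : ℕ} (Ψ : Finset (Fin n)) (η : ℕ)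
    (σ : Sig n) (ω : St n) : ℝ :=
  if ∃ i ∈ Ψ, σ i ≠ none ∧ σ i ≠ some (ω i) then 0
  else if η ≤ (Ψ.filter fun i => σ i = some (ω i)).card then 1
  else (1/2 : ℝ) ^ (η - (Ψ.filter fun i => σ i = some (ω i)).card)

def IsThreshold {n : ℕ} (S : Sig n → St n → ℝ) : Prop :=
  ∃ (Ψ : Finset (Fin n)) (η : ℕ), ∀ σ ω, S σ ω = thresholdScore Ψ η σ ω

end KS

namespace KS

lemma postProb_nonneg {n : ℕ} (σ : Sig n) (ω : St n) : 0 ≤ postProb σ ω := by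
  refine Finset.prod_nonneg fun i _ => ?_
  cases σ i with
  | none => norm_num
  | some b => simp only [Option.elim]; split_ifs <;> norm_num

/-- The posterior expectation of a product function factorizes over the tasks. -/
lemma postExp_prod {n : ℕ} (σ : Sig n) (g : Fin n → Bool → ℝ) :
    postExp σ (fun ω => ∏ i, g i (ω i)) =
      ∏ i, ∑ w : Bool,
        (σ i).elim ((1 : ℝ) / 2) (fun b => if w = b then 1 else 0) * g i w := by
  rw [Finset.prod_univ_sum, Fintype.piFinset_univ]
  simp only [postExp, postProb, Finset.prod_mul_distrib]

lemma sum_postProb {n : ℕ} (σ : Sig n) : ∑ ω, postProb σ ω = 1 := by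
  have h := postExp_prod σ (fun _ _ => 1)
  simp only [postExp, Finset.prod_const_one, mul_one] at h
  rw [h]
  refine Finset.prod_eq_one fun i _ => ?_
  cases σ i with
  | none => norm_num
  | some b => simp

lemma postExp_nonneg {n : ℕ} (σ : Sig n) {f : St n → ℝ} (hf : ∀ ω, 0 ≤ f ω) :
    0 ≤ postExp σ f :=
  Finset.sum_nonneg fun ω _ => mul_nonneg (postProb_nonneg σ ω) (hf ω)

lemma postExp_le {n : ℕ} (σ : Sig n) {f : St n → ℝ} {B : ℝ} (hf : ∀ ω, f ω ≤ B) :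
    postExp σ f ≤ B := by
  calc postExp σ f ≤ ∑ ω, postProb σ ω * B :=
        Finset.sum_le_sum fun ω _ => mul_le_mul_of_nonneg_left (hf ω) (postProb_nonneg σ ω)
    _ = B := by rw [← Finset.sum_mul, sum_postProb, one_mul]

lemma postExp_const_mul {n : ℕ} (σ : Sig n) (B : ℝ) (f : St n → ℝ) :
    postExp σ (fun ω => B * f ω) = B * postExp σ f := by
  simp only [postExp, Finset.mul_sum]
  exact Finset.sum_congr rfl fun ω _ => by ring

section SignalDistribution

variable {n : ℕ} {p : Fin n → ℝ}

lemma sigProb_nonneg (hp0 : ∀ i, 0 ≤ p i) (hp1 : ∀ i, p i ≤ 1) (Ψ : Finset (Fin n))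
    (σ : Sig n) : 0 ≤ sigProb p Ψ σ := by
  refine Finset.prod_nonneg fun i _ => ?_
  have h0 := hp0 i
  have h1 := hp1 i
  cases σ i <;> split_ifs <;> simp only [Option.elim] <;> linarith

/-- The expectation over signals of a product function factorizes over the tasks. -/
lemma sum_sigProb_mul_prod (p : Fin n → ℝ) (Ψ : Finset (Fin n))
    (g : Fin n → Option Bool → ℝ) :
    ∑ σ, sigProb p Ψ σ * ∏ i, g i (σ i) =
      ∏ i, ∑ s : Option Bool,
        (if i ∈ Ψ then s.elim (1 - p i) (fun _ => p i / 2)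
          else s.elim 1 (fun _ => 0)) * g i s := by
  rw [Finset.prod_univ_sum, Fintype.piFinset_univ]
  simp only [sigProb, Finset.prod_mul_distrib]

lemma sum_sigProb (p : Fin n → ℝ) (Ψ : Finset (Fin n)) : ∑ σ, sigProb p Ψ σ = 1 := by
  have h := sum_sigProb_mul_prod p Ψ (fun _ _ => 1)
  simp only [Finset.prod_const_one, mul_one] at h
  rw [h]
  refine Finset.prod_eq_one fun i _ => ?_
  split_ifs
  · simp [Fintype.sum_option]
    ring
  · simp [Fintype.sum_option]

lemma expScore_le (hp0 : ∀ i, 0 ≤ p i) (hp1 : ∀ i, p i ≤ 1) (Ψ : Finset (Fin n))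
    {S : Sig n → St n → ℝ} {B : ℝ} (hS : ∀ σ ω, S σ ω ≤ B) : expScore p Ψ S ≤ B := by
  calc expScore p Ψ S ≤ ∑ σ, sigProb p Ψ σ * B :=
        Finset.sum_le_sum fun σ _ =>
          mul_le_mul_of_nonneg_left (postExp_le σ (hS σ)) (sigProb_nonneg hp0 hp1 Ψ σ)
    _ = B := by rw [← Finset.sum_mul, sum_sigProb, one_mul]

lemma expScore_empty_ge (hp0 : ∀ i, 0 ≤ p i) (hp1 : ∀ i, p i ≤ 1)
    {S : Sig n → St n → ℝ} (hS : ∀ σ ω, 0 ≤ S σ ω) :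
    postExp (fun _ => none) (S fun _ => none) ≤ expScore p ∅ S := by
  have h := Finset.single_le_sum
    (f := fun σ => sigProb p ∅ σ * postExp σ (S σ))
    (fun σ _ => mul_nonneg (sigProb_nonneg hp0 hp1 ∅ σ) (postExp_nonneg σ (hS σ)))
    (Finset.mem_univ (fun _ => none))
  have h1 : sigProb p ∅ (fun _ => none) = 1 := by simp [sigProb]
  rw [h1, one_mul] at h
  exact h

/-- If the uninformed agent earns nothing under a nonnegative proper rule, the rule vanishes. -/
lemma Proper.eq_zero {S : Sig n → St n → ℝ} (hprop : Proper S) (hS : ∀ σ ω, 0 ≤ S σ ω)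
    (h0 : postExp (fun _ => none) (S fun _ => none) ≤ 0) (σ : Sig n) (ω : St n) :
    S σ ω = 0 := by
  have h1 : postExp (fun _ => none) (S σ) ≤ 0 := (hprop _ σ).trans h0
  have h2 : postProb (fun _ => none) ω * S σ ω ≤ 0 :=
    (Finset.single_le_sum (f := fun ω => postProb (fun _ => none) ω * S σ ω)
      (fun ω _ => mul_nonneg (postProb_nonneg _ ω) (hS σ ω)) (Finset.mem_univ ω)).trans h1
  have h3 : 0 < postProb (fun _ => none) ω :=
    Finset.prod_pos fun i _ => by norm_num
  exact le_antisymm (nonpos_of_mul_nonpos_right h2 h3) (hS σ ω)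

/-- With scores in `[0, B]`, the incentivized effort costs strictly less than `B`. -/
lemma IC.cost_lt (hp0 : ∀ i, 0 ≤ p i) (hp1 : ∀ i, p i ≤ 1) {c : Fin n → ℝ}
    {S : Sig n → St n → ℝ} {Ψ : Finset (Fin n)} {B : ℝ} (hB : 0 < B)
    (hS : ∀ σ ω, S σ ω ∈ Set.Icc 0 B) (hIC : IC p c S Ψ) : ∑ i ∈ Ψ, c i < B := by
  by_contra! hc
  have h1 := expScore_le hp0 hp1 Ψ fun σ ω => (hS σ ω).2
  have h2 := expScore_empty_ge hp0 hp1 fun σ ω => (hS σ ω).1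
  have h3 := hIC.2 ∅
  rw [Finset.sum_empty] at h3
  have hz := hIC.1.eq_zero (fun σ ω => (hS σ ω).1) (by linarith)
  have h4 : expScore p Ψ S = 0 := by simp [expScore, postExp, hz]
  have h5 := postExp_nonneg (fun _ => none) fun ω => (hS (fun _ => none) ω).1
  linarith

end SignalDistribution

/-- The factor of task `i` in `allOrNothing`. -/
noncomputable def taskFactor {n : ℕ} (Ψ : Finset (Fin n)) (i : Fin n) (s : Option Bool)
    (w : Bool) : ℝ :=
  if i ∈ Ψ then s.elim (1 / 2) (fun b => if w = b then 1 else 0) else 1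

/-- The rule paying `B` when all states in `Ψ` are reported correctly, nothing after a wrong
report, and discounting by `1/2` for each uninformative report on `Ψ`. -/
noncomputable def allOrNothing {n : ℕ} (B : ℝ) (Ψ : Finset (Fin n)) (σ : Sig n) (ω : St n) : ℝ :=
  B * ∏ i, taskFactor Ψ i (σ i) (ω i)

section AllOrNothing

variable {n : ℕ} {B : ℝ} (Ψ : Finset (Fin n))

lemma taskFactor_mem_Icc (i : Fin n) (s : Option Bool) (w : Bool) :
    taskFactor Ψ i s w ∈ Set.Icc (0 : ℝ) 1 := by
  unfold taskFactor
  cases s <;> simp only [Option.elim] <;> split_ifs <;> norm_num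

lemma allOrNothing_mem_Icc (hB : 0 ≤ B) (σ : Sig n) (ω : St n) :
    allOrNothing B Ψ σ ω ∈ Set.Icc 0 B :=
  ⟨mul_nonneg hB (Finset.prod_nonneg fun i _ => (taskFactor_mem_Icc Ψ i _ _).1),
    mul_le_of_le_one_right hB (Finset.prod_le_one
      (fun i _ => (taskFactor_mem_Icc Ψ i _ _).1) fun i _ => (taskFactor_mem_Icc Ψ i _ _).2)⟩

lemma postExp_allOrNothing (σ σ' : Sig n) :
    postExp σ (allOrNothing B Ψ σ') = B * ∏ i, ∑ w : Bool,
      (σ i).elim ((1 : ℝ) / 2) (fun b => if w = b then 1 else 0) * taskFactor Ψ i (σ' i) w := by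
  rw [← postExp_prod, ← postExp_const_mul]
  rfl

lemma proper_allOrNothing (hB : 0 ≤ B) : Proper (allOrNothing B Ψ) := by
  intro σ σ'
  rw [postExp_allOrNothing, postExp_allOrNothing]
  refine mul_le_mul_of_nonneg_left (Finset.prod_le_prod (fun i _ => ?_) fun i _ => ?_) hB
  · refine Finset.sum_nonneg fun w _ => mul_nonneg ?_ (taskFactor_mem_Icc Ψ i _ w).1
    cases σ i with
    | none => norm_num
    | some b => simp only [Option.elim]; split_ifs <;> norm_num
  · unfold taskFactor
    by_cases hi : i ∈ Ψ
    · rcases σ i with _ | _ | _ <;> rcases σ' i with _ | _ | _ <;> simp [hi] <;> norm_num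
    · simp [hi]

/-- With certain revelation, each shirked task of `Ψ` halves the expected score. -/
lemma expScore_allOrNothing {p : Fin n → ℝ} (hp : ∀ i, p i = 1) (Ψ' : Finset (Fin n)) :
    expScore p Ψ' (allOrNothing B Ψ) = B * (1 / 2) ^ (Ψ \ Ψ').card := by
  have h : expScore p Ψ' (allOrNothing B Ψ) = B * ∑ σ, sigProb p Ψ' σ * ∏ i, ∑ w : Bool,
      (σ i).elim ((1 : ℝ) / 2) (fun b => if w = b then 1 else 0) *
        taskFactor Ψ i (σ i) w := by
    simp only [expScore, postExp_allOrNothing, Finset.mul_sum]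
    exact Finset.sum_congr rfl fun σ _ => by ring
  rw [h, sum_sigProb_mul_prod p Ψ' (fun i s => ∑ w : Bool,
    s.elim ((1 : ℝ) / 2) (fun b => if w = b then 1 else 0) * taskFactor Ψ i s w)]
  congr 1
  rw [← Finset.prod_const, ← Finset.prod_subset (Finset.subset_univ (Ψ \ Ψ'))]
  · refine Finset.prod_congr rfl fun i hi => ?_
    rw [Finset.mem_sdiff] at hi
    simp [Fintype.sum_option, taskFactor, hi.1, hi.2]
    norm_num
  · intro i _ hi
    by_cases h1 : i ∈ Ψ <;> by_cases h2 : i ∈ Ψ' <;>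
      simp_all [Fintype.sum_option, taskFactor] <;> norm_num

end AllOrNothing

lemma sum_ite_lt {n l : ℕ} (g : Fin n → ℝ) (w : ℝ) (f : Fin (n + l) → ℝ)
    (hf : ∀ i : Fin (n + l), f i = if h : (i : ℕ) < n then g ⟨i, h⟩ else w)
    (Ψ : Finset (Fin (n + l))) :
    ∑ i ∈ Ψ, f i = ∑ i with Fin.castAdd l i ∈ Ψ, g i +
      ((Finset.univ.filter fun j : Fin l => Fin.natAdd n j ∈ Ψ).card : ℝ) * w := by
  have h : ∑ i ∈ Ψ, f i = ∑ i, if i ∈ Ψ then f i else 0 := by simp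
  rw [h, Fin.sum_univ_add, Finset.sum_filter, Finset.card_filter, Nat.cast_sum, Finset.sum_mul]
  congr 1
  · exact Finset.sum_congr rfl fun i _ => by simp [hf]
  · exact Finset.sum_congr rfl fun i _ => by simp [hf]

/-- If effort is cheap relative to the budget, which exceeds the cost of `Ψ` by `1`, then
`allOrNothing` incentivizes `Ψ`. -/
lemma ic_allOrNothing {n N : ℕ} {p c : Fin n → ℝ} {C B : ℝ} (hp : ∀ i, p i = 1)
    (hc0 : ∀ i, 0 ≤ c i) (hcC : ∀ i, c i ≤ C) (hC : 0 ≤ C) (hCB : 2 * (N * C) ≤ B)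
    (hpow : B ≤ 2 ^ N) {Ψ : Finset (Fin n)} (hΨ : ∑ i ∈ Ψ, c i = B - 1) :
    IC p c (allOrNothing B Ψ) Ψ := by
  have hB : 0 ≤ B := le_trans (by positivity) hCB
  refine ⟨proper_allOrNothing Ψ hB, fun Ψ' => ?_⟩
  rw [expScore_allOrNothing Ψ hp, expScore_allOrNothing Ψ hp, Finset.sdiff_self,
    Finset.card_empty, pow_zero, mul_one]
  have hD : ∑ i ∈ Ψ, c i ≤ ∑ i ∈ Ψ', c i + ∑ i ∈ Ψ \ Ψ', c i := by
    rw [← Finset.sum_union Finset.disjoint_sdiff]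
    exact Finset.sum_le_sum_of_subset_of_nonneg (by simp) fun i _ _ => hc0 i
  have hDC : ∑ i ∈ Ψ \ Ψ', c i ≤ (Ψ \ Ψ').card * C := by
    simpa using Finset.sum_le_card_nsmul _ _ _ fun i _ => hcC i
  have hc' : 0 ≤ ∑ i ∈ Ψ', c i := Finset.sum_nonneg fun i _ => hc0 i
  generalize (Ψ \ Ψ').card = j at hDC ⊢
  rcases Nat.eq_zero_or_pos j with rfl | hj
  · simp only [Nat.cast_zero, zero_mul] at hDC
    rw [pow_zero, mul_one]
    linarith
  · rcases le_total j N with hjN | hjN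
    · have h1 : (1 / 2 : ℝ) ^ j ≤ 1 / 2 :=
        pow_le_of_le_one (by norm_num) (by norm_num) hj.ne'
      have h2 : B * (1 / 2) ^ j ≤ B * (1 / 2) := mul_le_mul_of_nonneg_left h1 hB
      have h3 : (j : ℝ) * C ≤ N * C :=
        mul_le_mul_of_nonneg_right (by exact_mod_cast hjN) hC
      linarith
    · have h1 : B * (1 / 2) ^ j ≤ 1 := by
        calc B * (1 / 2) ^ j ≤ 2 ^ j * (1 / 2) ^ j :=
              mul_le_mul_of_nonneg_right
                (hpow.trans (pow_le_pow_right₀ (by norm_num) hjN)) (by positivity)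
          _ = 1 := by rw [← mul_pow]; norm_num
      linarith

/-- A set of items fitting the knapsack has value at most `Z + l * v`, and attains it only if it
solves the subset-sum instance. -/
lemma knapsack_value_le {n l Z C v b : ℕ} {z : Fin n → ℕ} (hv : v = 1 + ∑ i, z i)
    (A : Finset (Fin n)) (hb : b ≤ l) (hcost : ∑ i ∈ A, z i + b * C ≤ Z + l * C) :
    ∑ i ∈ A, z i + b * v ≤ Z + l * v ∧
      (∑ i ∈ A, z i + b * v = Z + l * v → ∑ i ∈ A, z i = Z) := by
  have hA : ∑ i ∈ A, z i ≤ ∑ i, z i := Finset.sum_le_sum_of_subset (Finset.subset_univ A)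
  rcases hb.eq_or_lt with rfl | hlt
  · exact ⟨by omega, by omega⟩
  · have h : (b + 1) * v ≤ l * v := Nat.mul_le_mul_right v hlt
    rw [add_mul, one_mul] at h
    exact ⟨by omega, by omega⟩

end KS

/-- Correctness of the subset-sum reduction: the optimal value of the constructed
knapsack scoring instance equals `Z + 2kn·v̄` iff the subset-sum instance is solvable. -/
theorem stmt3 (n : ℕ) (hn : 0 < n) (z : Fin n → ℕ) (Z : ℕ)
    (hzpos : ∀ i, 0 < z i) (hzZ : ∀ i, z i < Z) (hZ : 0 < Z)
    (k : ℕ) (hk : 0 < k)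
    (vbar cbar : ℕ) (hvbar : vbar = 1 + ∑ i, z i) (hcbar : cbar = 1 + Finset.univ.sup z)
    (hpow : Z + 2 * k * n * cbar + 1 < 2 ^ (k * n))
    (B : ℝ) (hB : B = (Z : ℝ) + 2 * k * n * cbar + 1)
    (m : ℕ) (hm : m = (2 * k + 1) * n)
    (cost val : Fin m → ℝ)
    (hcost : ∀ i : Fin m, cost i = if h : (i : ℕ) < n then ((z ⟨i, h⟩ : ℕ) : ℝ) else (cbar : ℝ))
    (hval : ∀ i : Fin m, val i = if h : (i : ℕ) < n then ((z ⟨i, h⟩ : ℕ) : ℝ) else (vbar : ℝ))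
    (p : Fin m → ℝ) (hp : ∀ i, p i = 1) :
    IsGreatest
      {x : ℝ | ∃ (S : KS.Sig m → KS.St m → ℝ) (Ψ : Finset (Fin m)),
        (∀ σ ω, S σ ω ∈ Set.Icc (0:ℝ) B) ∧ KS.IC p cost S Ψ ∧ x = ∑ i ∈ Ψ, val i}
      ((Z : ℝ) + 2 * k * n * vbar)
    ↔ ∃ Ψ : Finset (Fin n), ∑ i ∈ Ψ, z i = Z := by
  obtain rfl : m = n + 2 * k * n := by rw [hm]; ring
  have hp0 : ∀ i, 0 ≤ p i := fun i => by simp [hp]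
  have hp1 : ∀ i, p i ≤ 1 := fun i => (hp i).le
  have hBpos : 0 < B := by rw [hB]; positivity
  have key : ∀ (S : KS.Sig (n + 2 * k * n) → KS.St (n + 2 * k * n) → ℝ)
      (Ψ : Finset (Fin (n + 2 * k * n))), (∀ σ ω, S σ ω ∈ Set.Icc (0 : ℝ) B) →
      KS.IC p cost S Ψ → ∑ i ∈ Ψ, val i ≤ (Z : ℝ) + 2 * k * n * vbar ∧
        (∑ i ∈ Ψ, val i = (Z : ℝ) + 2 * k * n * vbar →
          ∃ A : Finset (Fin n), ∑ i ∈ A, z i = Z) := by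
    intro S Ψ hS hIC
    have hlt := hIC.cost_lt hp0 hp1 hBpos hS
    rw [KS.sum_ite_lt (fun i => (z i : ℝ)) _ cost hcost Ψ, hB] at hlt
    rw [KS.sum_ite_lt (fun i => (z i : ℝ)) _ val hval Ψ]
    set A := Finset.univ.filter fun i : Fin n => Fin.castAdd (2 * k * n) i ∈ Ψ
    set L := Finset.univ.filter fun j : Fin (2 * k * n) => Fin.natAdd n j ∈ Ψ
    have hL : L.card ≤ 2 * k * n := by simpa using Finset.card_le_univ L
    have hlt' : ∑ i ∈ A, z i + L.card * cbar < Z + 2 * k * n * cbar + 1 := by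
      exact_mod_cast hlt
    obtain ⟨h1, h2⟩ := KS.knapsack_value_le hvbar A hL (Nat.lt_succ_iff.mp hlt')
    exact ⟨by exact_mod_cast h1, fun h => ⟨A, h2 (by exact_mod_cast h)⟩⟩
  constructor
  · rintro ⟨⟨S, Ψ, hS, hIC, hx⟩, -⟩
    exact (key S Ψ hS hIC).2 hx.symm
  · rintro ⟨A, hA⟩
    refine ⟨?_, ?_⟩
    · let Ψ : Finset (Fin (n + 2 * k * n)) :=
        Finset.univ.filter fun i => ∀ h : (i : ℕ) < n, (⟨i, h⟩ : Fin n) ∈ A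
      have hΨA : (Finset.univ.filter fun i : Fin n => Fin.castAdd (2 * k * n) i ∈ Ψ) = A := by
        ext i; simp [Ψ]
      have hΨL : (Finset.univ.filter fun j : Fin (2 * k * n) => Fin.natAdd n j ∈ Ψ) =
          Finset.univ := by
        ext j; simp [Ψ]
      have hA' : ∑ i ∈ A, (z i : ℝ) = Z := by exact_mod_cast hA
      have hsum : ∀ (w : ℝ) (f : Fin (n + 2 * k * n) → ℝ),
          (∀ i : Fin (n + 2 * k * n),
            f i = if h : (i : ℕ) < n then ((z ⟨i, h⟩ : ℕ) : ℝ) else w) →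
          ∑ i ∈ Ψ, f i = (Z : ℝ) + 2 * k * n * w := by
        intro w f hf
        rw [KS.sum_ite_lt (fun i => (z i : ℝ)) _ f hf Ψ, hΨA, hΨL, hA', Finset.card_univ, Fintype.card_fin]
        push_cast
        rfl
      refine ⟨KS.allOrNothing B Ψ, Ψ, KS.allOrNothing_mem_Icc Ψ hBpos.le, ?_,
        (hsum _ val hval).symm⟩
      refine KS.ic_allOrNothing (N := k * n) (C := cbar) hp (fun i => ?_) (fun i => ?_)
        (Nat.cast_nonneg _) ?_ ?_ ?_
      · rw [hcost]; split_ifs <;> positivity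
      · rw [hcost]
        split_ifs with h
        · have hle : z ⟨i, h⟩ ≤ cbar := by
            have := Finset.le_sup (f := z) (Finset.mem_univ ⟨i, h⟩)
            omega
          exact_mod_cast hle
        · exact le_rfl
      · have : (0 : ℝ) ≤ Z := Nat.cast_nonneg _
        rw [hB]
        push_cast
        linarith
      · rw [hB]
        exact_mod_cast hpow.le
      · rw [hsum _ cost hcost, hB]
        ring
    · rintro x ⟨S, Ψ, hS, hIC, rfl⟩
      exact (key S Ψ hS hIC).1
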